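/- Let {X_{n,i}} be, for each n, a centered stationary Gaussian sequence with unit variances and correlations ϱ_{n,j}, and let S be a nonnegative random variable with P(S > 1 - 1/u) ~ c·u^{-τ} as u → ∞ (c > 0, τ ≥ 0), independent of the array. Define u_n(x) = a_n x + b_n with a_n = (2 ln n)^{-1/2} and b_n = (2 ln n)^{1/2} + (2 ln n)^{-1/2}(ln(c(2π)^{-1/2}Γ(1+τ)) - ((2τ+1)/2)(ln ln n + ln 2)). Then lim_{n→∞} n·P(S·X_{n,1} > u_n(x)) = e^{-x} for every x ∈ ℝ. -/

import Mathlib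

open Real MeasureTheory ProbabilityTheory Filter

theorem iUnion_Ioc_zpow_eq_Ioi {r : ℝ} (hr : 1 < r) :
    ⋃ i : ℤ, Set.Ioc (r ^ i) (r ^ (i + 1)) = Set.Ioi 0 := by
  ext x
  simp only [Set.mem_iUnion, Set.mem_Ioi]
  exact ⟨fun ⟨i, hi⟩ => (zpow_pos (by linarith) i).trans hi.1, fun hx => exists_mem_Ioc_zpow hx hr⟩

theorem pairwise_disjoint_Ioc_zpow_real {r : ℝ} (hr : 1 < r) :
    Pairwise (Function.onFun Disjoint fun i : ℤ => Set.Ioc (r ^ i) (r ^ (i + 1))) :=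
  (zpow_right_mono₀ hr.le).pairwise_disjoint_on_Ioc_succ

section Product

variable {Ω : Type*} [MeasurableSpace Ω] {P : Measure Ω} {S X : Ω → ℝ}

theorem measure_preimage_Ioi_inter_eq_tsum (hX : AEMeasurable X P) (E : Set Ω) {r : ℝ}
    (hr : 1 < r) :
    P (X ⁻¹' Set.Ioi 0 ∩ E) = ∑' i : ℤ, P (X ⁻¹' Set.Ioc (r ^ i) (r ^ (i + 1)) ∩ E) := by
  have key : ∀ B : Set ℝ, MeasurableSet B → (P.restrict E).map X B = P (X ⁻¹' B ∩ E) := by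
    intro B hB
    rw [Measure.map_apply_of_aemeasurable hX.restrict hB,
      Measure.restrict_apply₀ (hX.restrict.nullMeasurable hB)]
  rw [← key _ measurableSet_Ioi, ← iUnion_Ioc_zpow_eq_Ioi hr,
    measure_iUnion (pairwise_disjoint_Ioc_zpow_real hr) fun _ => measurableSet_Ioc]
  exact tsum_congr fun i => key _ measurableSet_Ioc

theorem antitone_measure_gt (P : Measure Ω) (S : Ω → ℝ) : Antitone fun s => P {ω | S ω > s} :=
  fun _ _ h => measure_mono fun _ hω => lt_of_le_of_lt h hω

theorem measure_mul_gt_le_lintegral (hX : AEMeasurable X P) (hS : ∀ ω, 0 ≤ S ω)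
    (hind : IndepFun S X P) {u v : ℝ} (hv : 0 < v) (hvu : v < u) :
    P {ω | S ω * X ω > u} ≤ ∫⁻ x in Set.Ioi 0, P {ω | S ω > v / x} ∂(P.map X) := by
  have hr : 1 < u / v := (one_lt_div hv).2 hvu
  have hr0 : 0 < u / v := by linarith
  have hE : {ω | S ω * X ω > u} = X ⁻¹' Set.Ioi 0 ∩ {ω | S ω * X ω > u} := by
    refine (Set.inter_eq_right.2 fun ω hω => ?_).symm
    have hω : u < S ω * X ω := hω
    exact pos_of_mul_pos_right (by linarith) (hS ω)
  rw [hE, measure_preimage_Ioi_inter_eq_tsum hX _ hr, ← iUnion_Ioc_zpow_eq_Ioi hr,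
    lintegral_iUnion (fun _ => measurableSet_Ioc) (pairwise_disjoint_Ioc_zpow_real hr)]
  refine ENNReal.tsum_le_tsum fun i => ?_
  have hi : 0 < (u / v) ^ i := zpow_pos hr0 i
  have hi' : 0 < (u / v) ^ (i + 1) := zpow_pos hr0 _
  calc P (X ⁻¹' Set.Ioc ((u / v) ^ i) ((u / v) ^ (i + 1)) ∩ {ω | S ω * X ω > u})
      ≤ P (S ⁻¹' Set.Ioi (u / (u / v) ^ (i + 1)) ∩
          X ⁻¹' Set.Ioc ((u / v) ^ i) ((u / v) ^ (i + 1))) := by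
        refine measure_mono fun ω hω => ⟨?_, hω.1⟩
        have h1 : u < S ω * X ω := hω.2
        have h2 : X ω ≤ (u / v) ^ (i + 1) := hω.1.2
        change u / (u / v) ^ (i + 1) < S ω
        rw [div_lt_iff₀ hi']
        nlinarith [hS ω]
    _ = ∫⁻ _ in Set.Ioc ((u / v) ^ i) ((u / v) ^ (i + 1)),
          P {ω | S ω > u / (u / v) ^ (i + 1)} ∂(P.map X) := by
        rw [hind.measure_inter_preimage_eq_mul _ _ measurableSet_Ioi measurableSet_Ioc,
          setLIntegral_const, Measure.map_apply_of_aemeasurable hX measurableSet_Ioc]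
        rfl
    _ ≤ _ := by
        refine setLIntegral_mono' measurableSet_Ioc fun x hx => antitone_measure_gt P S ?_
        have : u / (u / v) ^ (i + 1) = v / (u / v) ^ i := by
          rw [zpow_add_one₀ hr0.ne']
          have : u ≠ 0 := by linarith
          field_simp
        rw [this]
        exact div_le_div_of_nonneg_left hv.le hi hx.1.le

theorem lintegral_le_measure_mul_gt (hX : AEMeasurable X P)
    (hind : IndepFun S X P) {u v : ℝ} (hu : 0 < u) (huv : u < v) :
    ∫⁻ x in Set.Ioi 0, P {ω | S ω > v / x} ∂(P.map X) ≤ P {ω | S ω * X ω > u} := by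
  have hr : 1 < v / u := (one_lt_div hu).2 huv
  have hr0 : 0 < v / u := by linarith
  refine le_trans ?_ (measure_mono (Set.inter_subset_right (s := X ⁻¹' Set.Ioi 0)))
  rw [measure_preimage_Ioi_inter_eq_tsum hX _ hr, ← iUnion_Ioc_zpow_eq_Ioi hr,
    lintegral_iUnion (fun _ => measurableSet_Ioc) (pairwise_disjoint_Ioc_zpow_real hr)]
  refine ENNReal.tsum_le_tsum fun i => ?_
  have hi : 0 < (v / u) ^ i := zpow_pos hr0 i
  have hi' : 0 < (v / u) ^ (i + 1) := zpow_pos hr0 _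
  calc _ ≤ ∫⁻ _ in Set.Ioc ((v / u) ^ i) ((v / u) ^ (i + 1)),
          P {ω | S ω > u / (v / u) ^ i} ∂(P.map X) := by
        refine setLIntegral_mono' measurableSet_Ioc fun x hx => antitone_measure_gt P S ?_
        have : u / (v / u) ^ i = v / (v / u) ^ (i + 1) := by
          rw [zpow_add_one₀ hr0.ne']
          have : v ≠ 0 := by linarith
          field_simp
        rw [this]
        exact div_le_div_of_nonneg_left (by linarith) (hi.trans hx.1) hx.2
    _ = P (S ⁻¹' Set.Ioi (u / (v / u) ^ i) ∩
          X ⁻¹' Set.Ioc ((v / u) ^ i) ((v / u) ^ (i + 1))) := by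
        rw [hind.measure_inter_preimage_eq_mul _ _ measurableSet_Ioi measurableSet_Ioc,
          setLIntegral_const, Measure.map_apply_of_aemeasurable hX measurableSet_Ioc]
        rfl
    _ ≤ _ := by
        refine measure_mono fun ω hω => ⟨hω.2, ?_⟩
        have h1 : u / (v / u) ^ i < S ω := hω.1
        have h2 : (v / u) ^ i < X ω := hω.2.1
        change u < S ω * X ω
        have hS : 0 < S ω := (div_pos hu hi).trans h1
        rw [div_lt_iff₀ hi] at h1
        exact h1.trans (mul_lt_mul_of_pos_left h2 hS)

end Product

theorem exists_tail_bound {g : ℝ → ℝ} (hg1 : ∀ s, g s ≤ 1) {c τ : ℝ} (hc : 0 < c) (hτ : 0 ≤ τ)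
    (htail : Tendsto (fun u : ℝ => g (1 - 1 / u) / (c * u ^ (-τ))) atTop (nhds 1)) :
    ∃ C, ∀ v, 1 ≤ v → g (1 - 1 / v) ≤ C * v ^ (-τ) := by
  obtain ⟨V, hV⟩ := eventually_atTop.1 (htail.eventually (gt_mem_nhds (show (1 : ℝ) < 2 by norm_num)))
  set W := max V 1 with hW
  refine ⟨max (2 * c) (W ^ τ), fun v hv => ?_⟩
  have hv0 : 0 < v := by linarith
  have hpos : 0 < v ^ (-τ) := rpow_pos_of_pos hv0 _
  rcases le_total W v with h | h
  · have := hV v ((le_max_left _ _).trans h)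
    rw [div_lt_iff₀ (by positivity)] at this
    calc g (1 - 1 / v) ≤ (2 * c) * v ^ (-τ) := by linarith
      _ ≤ _ := by gcongr; exact le_max_left _ _
  · calc g (1 - 1 / v) ≤ v ^ τ * v ^ (-τ) := by
          rw [← rpow_add hv0]; simpa using hg1 _
      _ ≤ W ^ τ * v ^ (-τ) := by gcongr
      _ ≤ _ := by gcongr; exact le_max_right _ _

theorem rpow_mul_rpow_neg_eq {u t τ : ℝ} (hu : 0 < u) (ht : 0 < t) :
    u ^ (2 * τ) * (1 + u ^ 2 / t) ^ (-τ) = (u ^ 2 * t / (t + u ^ 2)) ^ τ := by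
  have h : u ^ 2 * t / (t + u ^ 2) = u ^ 2 * (1 + u ^ 2 / t)⁻¹ := by field_simp
  have h2 : u ^ (2 * τ) = (u ^ 2) ^ τ := by
    rw [← rpow_natCast, ← rpow_mul hu.le]; norm_num
  rw [h, mul_rpow (by positivity) (by positivity), h2, inv_rpow (by positivity),
    rpow_neg (by positivity)]

theorem integral_gaussianReal_div_eq {g : ℝ → ℝ} (hg : ∀ s, 1 ≤ s → g s = 0) (τ : ℝ) {u : ℝ}
    (hu : 0 < u) :
    √(2 * π) * exp (u ^ 2 / 2) * u ^ (2 * τ + 1) * ∫ x in Set.Ioi 0, g (u / x) ∂gaussianReal 0 1 =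
      ∫ t in Set.Ioi 0, u ^ (2 * τ) * g (1 - 1 / (1 + u ^ 2 / t)) *
        exp (-t - t ^ 2 / (2 * u ^ 2)) := by
  set H : ℝ → ℝ := fun x => gaussianPDFReal 0 1 x * (Set.Ioi 0).indicator (fun x => g (u / x)) x
    with hH
  have e1 : ∫ x in Set.Ioi 0, g (u / x) ∂gaussianReal 0 1 = ∫ x, H x := by
    rw [← integral_indicator measurableSet_Ioi, integral_gaussianReal_eq_integral_smul one_ne_zero]
    rfl
  have e2 : u * ∫ x, H x = ∫ t, H (u + u⁻¹ * t) := by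
    rw [Measure.integral_comp_mul_left (fun y => H (u + y)) u⁻¹, integral_add_left_eq_self,
      inv_inv, abs_of_pos hu, smul_eq_mul]
  rw [e1, rpow_add_one hu.ne']
  calc _ = √(2 * π) * exp (u ^ 2 / 2) * u ^ (2 * τ) * (u * ∫ x, H x) := by ring
    _ = _ := by
      rw [e2, ← integral_const_mul, ← integral_indicator measurableSet_Ioi]
      refine integral_congr_ae (Eventually.of_forall fun t => ?_)
      simp only [hH]
      rcases le_or_gt t 0 with ht | ht
      · rw [Set.indicator_of_notMem (s := Set.Ioi 0) (a := t) (by simpa using ht)]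
        by_cases hm : u + u⁻¹ * t ∈ Set.Ioi (0 : ℝ)
        · rw [Set.indicator_of_mem hm, hg, mul_zero, mul_zero]
          rw [one_le_div hm]
          have : u⁻¹ * t ≤ 0 := mul_nonpos_of_nonneg_of_nonpos (by positivity) ht
          linarith
        · rw [Set.indicator_of_notMem hm, mul_zero, mul_zero]
      · have hm : u + u⁻¹ * t ∈ Set.Ioi (0 : ℝ) := by simp only [Set.mem_Ioi]; positivity
        rw [Set.indicator_of_mem hm, Set.indicator_of_mem (s := Set.Ioi 0) (a := t) ht]
        have a1 : u / (u + u⁻¹ * t) = 1 - 1 / (1 + u ^ 2 / t) := by field_simp; ring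
        have a2 : √(2 * π) * exp (u ^ 2 / 2) * gaussianPDFReal 0 1 (u + u⁻¹ * t) =
            exp (-t - t ^ 2 / (2 * u ^ 2)) := by
          have : √(2 * π) ≠ 0 := by positivity
          simp only [gaussianPDFReal, NNReal.coe_one, mul_one, sub_zero]
          calc _ = √(2 * π) * (√(2 * π))⁻¹ * (exp (u ^ 2 / 2) * exp (-(u + u⁻¹ * t) ^ 2 / 2)) := by
                ring
            _ = _ := by
              rw [mul_inv_cancel₀ this, one_mul, ← exp_add]
              congr 1
              field_simp
              ring
        rw [a1, ← a2]
        ring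

theorem tendsto_integral_gaussianReal_div {g : ℝ → ℝ} (hanti : Antitone g) (hg0 : ∀ s, 0 ≤ g s)
    (hg1 : ∀ s, g s ≤ 1) (hg : ∀ s, 1 ≤ s → g s = 0) {c τ : ℝ} (hc : 0 < c) (hτ : 0 ≤ τ)
    (htail : Tendsto (fun u : ℝ => g (1 - 1 / u) / (c * u ^ (-τ))) atTop (nhds 1)) :
    Tendsto (fun u : ℝ => √(2 * π) * exp (u ^ 2 / 2) * u ^ (2 * τ + 1) *
      ∫ x in Set.Ioi 0, g (u / x) ∂gaussianReal 0 1) atTop (nhds (c * Gamma (1 + τ))) := by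
  obtain ⟨C, hC⟩ := exists_tail_bound hg1 hc hτ htail
  have hC0 : 0 ≤ C := by simpa using (hg0 _).trans (hC 1 le_rfl)
  have hΓ : c * Gamma (1 + τ) = ∫ t in Set.Ioi 0, c * (exp (-t) * t ^ τ) := by
    rw [Gamma_eq_integral (by linarith), integral_const_mul]
    simp
  rw [hΓ]
  refine Tendsto.congr' (f₁ := fun u : ℝ => ∫ t in Set.Ioi 0,
    u ^ (2 * τ) * g (1 - 1 / (1 + u ^ 2 / t)) * exp (-t - t ^ 2 / (2 * u ^ 2))) ?_ ?_
  · filter_upwards [eventually_gt_atTop 0] with u hu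
    exact (integral_gaussianReal_div_eq hg τ hu).symm
  have hgm : Measurable g := hanti.measurable
  refine tendsto_integral_filter_of_dominated_convergence (fun t => C * (exp (-t) * t ^ τ))
    ?_ ?_ ?_ ?_
  · exact Eventually.of_forall fun u => Measurable.aestronglyMeasurable (by fun_prop)
  · filter_upwards [eventually_gt_atTop 0] with u hu
    filter_upwards [ae_restrict_mem measurableSet_Ioi] with t ht
    have ht : 0 < t := ht
    have h0 := hg0 (1 - 1 / (1 + u ^ 2 / t))
    rw [norm_of_nonneg (by positivity)]
    have h1 : u ^ (2 * τ) * g (1 - 1 / (1 + u ^ 2 / t)) ≤ C * t ^ τ := by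
      calc _ ≤ u ^ (2 * τ) * (C * (1 + u ^ 2 / t) ^ (-τ)) := by
            gcongr
            exact hC _ (by simp only [le_add_iff_nonneg_right]; positivity)
        _ = C * (u ^ 2 * t / (t + u ^ 2)) ^ τ := by
            rw [← rpow_mul_rpow_neg_eq hu ht]; ring
        _ ≤ _ := by
            gcongr
            rw [div_le_iff₀ (by positivity)]
            nlinarith
    have h2 : exp (-t - t ^ 2 / (2 * u ^ 2)) ≤ exp (-t) := by
      gcongr
      simp only [sub_le_self_iff]
      positivity
    calc _ ≤ (C * t ^ τ) * exp (-t) := by gcongr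
      _ = _ := by ring
  · have := (GammaIntegral_convergent (s := 1 + τ) (by linarith)).const_mul C
    simpa [IntegrableOn] using this
  · filter_upwards [ae_restrict_mem measurableSet_Ioi] with t ht
    have ht : 0 < t := ht
    have hsq : Tendsto (fun u : ℝ => u ^ 2) atTop atTop := tendsto_pow_atTop two_ne_zero
    have hv : Tendsto (fun u : ℝ => 1 + u ^ 2 / t) atTop atTop :=
      tendsto_atTop_add_const_left _ _ (hsq.atTop_div_const ht)
    have h1 := htail.comp hv
    have h2 : Tendsto (fun u : ℝ => u ^ 2 * t / (t + u ^ 2)) atTop (nhds t) := by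
      have : Tendsto (fun u : ℝ => t / (t / u ^ 2 + 1)) atTop (nhds (t / (0 + 1))) :=
        tendsto_const_nhds.div ((tendsto_const_nhds.div_atTop hsq).add_const 1) (by norm_num)
      rw [zero_add, div_one] at this
      refine this.congr' ?_
      filter_upwards [eventually_gt_atTop 0] with u hu
      field_simp
    have h3 : Tendsto (fun u : ℝ => exp (-t - t ^ 2 / (2 * u ^ 2))) atTop (nhds (exp (-t - 0))) :=
      (continuous_exp.tendsto _).comp (tendsto_const_nhds.sub
        (tendsto_const_nhds.div_atTop (hsq.const_mul_atTop two_pos)))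
    have h4 := ((h1.mul (h2.rpow_const (p := τ) (Or.inr hτ))).const_mul c).mul h3
    rw [show c * (exp (-t) * t ^ τ) = c * (1 * t ^ τ) * exp (-t - 0) by rw [sub_zero]; ring]
    refine h4.congr' ?_
    filter_upwards [eventually_gt_atTop 0] with u hu
    rw [← rpow_mul_rpow_neg_eq hu ht]
    have : (1 + u ^ 2 / t) ^ (-τ) ≠ 0 := (rpow_pos_of_pos (by positivity) _).ne'
    simp only [Function.comp]
    field_simp

theorem tendsto_log_pow_div_id (k : ℕ) : Tendsto (fun L : ℝ => log L ^ k / L) atTop (nhds 0) :=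
  isLittleO_pow_log_id_atTop.tendsto_div_nhds_zero

theorem tendsto_affine_log_div (d q : ℝ) :
    Tendsto (fun L : ℝ => (d - q / 2 * log L) / L) atTop (nhds 0) := by
  have h := (tendsto_inv_atTop_zero (𝕜 := ℝ)).const_mul d |>.sub
    ((tendsto_log_pow_div_id 1).const_mul (q / 2))
  simp only [mul_zero, sub_zero] at h
  exact h.congr fun L => by ring

theorem tendsto_affine_log_sq_div (d q : ℝ) :
    Tendsto (fun L : ℝ => (d - q / 2 * log L) ^ 2 / (2 * L)) atTop (nhds 0) := by
  have h := (((tendsto_inv_atTop_zero (𝕜 := ℝ)).const_mul (d ^ 2 / 2)).sub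
    ((tendsto_log_pow_div_id 1).const_mul (d * q / 2))).add
    ((tendsto_log_pow_div_id 2).const_mul (q ^ 2 / 8))
  simp only [mul_zero, sub_zero, add_zero] at h
  refine h.congr' ?_
  filter_upwards [eventually_gt_atTop 0] with L hL
  field_simp
  ring

theorem sqrt_add_div_sqrt {L : ℝ} (hL : 0 < L) (w : ℝ) : √L + w / √L = √L * (1 + w / L) := by
  have h : √L ≠ 0 := by positivity
  nth_rewrite 4 [← sq_sqrt hL.le]
  field_simp

theorem tendsto_sqrt_add_affine_log_div_sqrt (d q : ℝ) :
    Tendsto (fun L : ℝ => √L + (d - q / 2 * log L) / √L) atTop atTop := by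
  have h := (tendsto_affine_log_div d q).const_add 1
  rw [add_zero] at h
  refine (tendsto_sqrt_atTop.atTop_mul_pos one_pos h).congr' ?_
  filter_upwards [eventually_gt_atTop 0] with L hL
  exact (sqrt_add_div_sqrt hL _).symm

theorem tendsto_exp_sq_mul_rpow (d q : ℝ) :
    Tendsto (fun L : ℝ => exp ((√L + (d - q / 2 * log L) / √L) ^ 2 / 2 - L / 2) *
      (√L + (d - q / 2 * log L) / √L) ^ q) atTop (nhds (exp d)) := by
  have h1 := (tendsto_affine_log_div d q).const_add 1
  have h2 : Tendsto (fun L : ℝ => exp ((d - q / 2 * log L) ^ 2 / (2 * L))) atTop (nhds (exp 0)) :=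
    (continuous_exp.tendsto _).comp (tendsto_affine_log_sq_div d q)
  have h3 := (h2.mul (h1.rpow_const (p := q) (Or.inl (by norm_num)))).const_mul (exp d)
  simp only [exp_zero, add_zero, one_rpow, mul_one] at h3
  refine h3.congr' ?_
  rw [add_zero] at h1
  filter_upwards [eventually_gt_atTop 0, h1.eventually (lt_mem_nhds one_pos)] with L hL hpos
  set w := d - q / 2 * log L with hw
  have hs : √L ^ 2 = L := sq_sqrt hL.le
  have e1 : (√L + w / √L) ^ 2 / 2 - L / 2 = w + w ^ 2 / (2 * L) := by
    rw [sqrt_add_div_sqrt hL, mul_pow, hs]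
    field_simp
    ring
  have e2 : exp w * √L ^ q = exp d := by
    rw [sqrt_eq_rpow, ← rpow_mul hL.le, rpow_def_of_pos hL, ← exp_add]
    congr 1
    rw [hw]
    ring
  rw [e1, sqrt_add_div_sqrt hL, mul_rpow (by positivity) hpos.le, exp_add, ← e2]
  ring

theorem tendsto_nat_mul_of_norming {J : ℝ → ℝ} {A q x : ℝ} (hA : 0 < A)
    (hJ : Tendsto (fun u : ℝ => √(2 * π) * exp (u ^ 2 / 2) * u ^ q * J u) atTop (nhds A)) :
    Tendsto (fun n : ℕ => (n : ℝ) * J (√(2 * log n) +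
      (x + log (A / √(2 * π)) - q / 2 * log (2 * log n)) / √(2 * log n))) atTop
      (nhds (exp (-x))) := by
  set d := x + log (A / √(2 * π)) with hd
  have hL : Tendsto (fun n : ℕ => 2 * log n) atTop atTop :=
    (tendsto_log_atTop.comp tendsto_natCast_atTop_atTop).const_mul_atTop two_pos
  have hU := (tendsto_sqrt_add_affine_log_div_sqrt d q).comp hL
  have h1 := (hJ.comp hU).div (((tendsto_exp_sq_mul_rpow d q).comp hL).const_mul √(2 * π))
    (by positivity)
  have e : A / (√(2 * π) * exp d) = exp (-x) := by
    rw [hd, exp_add, exp_log (by positivity), exp_neg]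
    have := exp_pos x
    field_simp
  rw [e] at h1
  refine h1.congr' ?_
  filter_upwards [hU.eventually_gt_atTop 0, eventually_gt_atTop 0] with n hn hn0
  have hn0' : (0 : ℝ) < n := by exact_mod_cast hn0
  have hne : exp (2 * log n / 2) = n := by
    rw [mul_div_cancel_left₀ _ two_ne_zero, exp_log hn0']
  simp only [Function.comp, Pi.div_apply] at hn ⊢
  rw [exp_sub, hne]
  set U := √(2 * log n) + (d - q / 2 * log (2 * log n)) / √(2 * log n)
  have hUq : 0 < U ^ q := rpow_pos_of_pos hn q
  have := exp_pos (U ^ 2 / 2)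
  have : 0 < √(2 * π) := by positivity
  field_simp

theorem stmt_10 {Ω : Type*} [MeasureSpace Ω] [IsProbabilityMeasure (ℙ : Measure Ω)]
    (S X : Ω → ℝ) (hSrange : ∀ ω, S ω ∈ Set.Icc (0:ℝ) 1)
    (hX : Measure.map X ℙ = gaussianReal 0 1)
    (hindep : IndepFun S X)
    (c τ : ℝ) (hc : 0 < c) (hτ : 0 ≤ τ)
    (htail : Tendsto (fun u : ℝ => (ℙ {ω | S ω > 1 - 1 / u}).toReal / (c * u ^ (-τ)))
      atTop (nhds 1))
    (a b : ℕ → ℝ)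
    (ha : ∀ n : ℕ, a n = (2 * Real.log n) ^ (-(1:ℝ)/2))
    (hb : ∀ n : ℕ, b n = (2 * Real.log n) ^ ((1:ℝ)/2) +
      (2 * Real.log n) ^ (-(1:ℝ)/2) *
        (Real.log (c * (2 * Real.pi) ^ (-(1:ℝ)/2) * Real.Gamma (1 + τ)) -
          ((2 * τ + 1) / 2) * (Real.log (Real.log n) + Real.log 2))) :
    ∀ x : ℝ, Tendsto (fun n : ℕ => (n : ℝ) * (ℙ {ω | S ω * X ω > a n * x + b n}).toReal)
      atTop (nhds (Real.exp (-x))) := by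
  have hXm : AEMeasurable X ℙ := by
    by_contra h
    rw [Measure.map_of_not_aemeasurable h] at hX
    exact IsProbabilityMeasure.ne_zero (gaussianReal 0 1) hX.symm
  have hanti := antitone_measure_gt (ℙ : Measure Ω) S
  set g : ℝ → ℝ := fun s => (ℙ {ω | S ω > s}).toReal with hg
  set J : ℝ → ℝ := fun v => ∫ x in Set.Ioi 0, g (v / x) ∂gaussianReal 0 1 with hJ
  have hJ_eq : ∀ v, J v =
      (∫⁻ x in Set.Ioi 0, ℙ {ω | S ω > v / x} ∂(Measure.map X ℙ)).toReal := by
    intro v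
    rw [hX]
    refine integral_toReal ?_ (Eventually.of_forall fun x => measure_lt_top _ _)
    exact (hanti.measurable.comp (measurable_const.div measurable_id)).aemeasurable
  have hJ_top : ∀ v, ∫⁻ x in Set.Ioi 0, ℙ {ω | S ω > v / x} ∂(Measure.map X ℙ) ≠ ⊤ := by
    intro v
    rw [hX]
    refine ((setLIntegral_mono measurable_const fun x _ => prob_le_one).trans_lt ?_).ne
    rw [setLIntegral_const, one_mul]
    exact measure_lt_top _ _
  have upper : ∀ u v : ℝ, 0 < v → v < u → (ℙ {ω | S ω * X ω > u}).toReal ≤ J v := by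
    intro u v hv hvu
    rw [hJ_eq]
    exact ENNReal.toReal_mono (hJ_top v)
      (measure_mul_gt_le_lintegral hXm (fun ω => (hSrange ω).1) hindep hv hvu)
  have lower : ∀ u v : ℝ, 0 < u → u < v → J v ≤ (ℙ {ω | S ω * X ω > u}).toReal := by
    intro u v hu huv
    rw [hJ_eq]
    exact ENNReal.toReal_mono (measure_ne_top _ _)
      (lintegral_le_measure_mul_gt hXm hindep hu huv)
  have hJlim := tendsto_integral_gaussianReal_div (g := g)
    (fun s t h => ENNReal.toReal_mono (measure_ne_top _ _) (hanti h))
    (fun _ => ENNReal.toReal_nonneg) (fun _ => measureReal_le_one)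
    (fun s hs => by
      have : {ω | S ω > s} = ∅ :=
        Set.eq_empty_of_forall_notMem fun ω hω => absurd ((hSrange ω).2.trans hs) (not_le.2 hω)
      simp [hg, this]) hc hτ htail
  have hΓ : 0 < Gamma (1 + τ) := Gamma_pos_of_pos (by linarith)
  have hL : Tendsto (fun n : ℕ => 2 * log n) atTop atTop :=
    (tendsto_log_atTop.comp tendsto_natCast_atTop_atTop).const_mul_atTop two_pos
  have ha_pos : ∀ᶠ n in atTop, 0 < a n := by
    filter_upwards [hL.eventually_gt_atTop 0] with n hn
    rw [ha]
    positivity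
  have hu_eq : ∀ y, ∀ᶠ n : ℕ in atTop, a n * y + b n = √(2 * log n) +
      (y + log (c * Gamma (1 + τ) / √(2 * π)) - (2 * τ + 1) / 2 * log (2 * log n)) /
        √(2 * log n) := by
    intro y
    filter_upwards [hL.eventually_gt_atTop 0] with n hn
    have hr : ∀ z : ℝ, 0 < z → z ^ (-(1 : ℝ) / 2) = (√z)⁻¹ := fun z hz => by
      rw [neg_div, rpow_neg hz.le, sqrt_eq_rpow]
    rw [ha, hb, hr _ hn, hr _ (by positivity), ← sqrt_eq_rpow,
      log_mul two_ne_zero (by linarith : log (n : ℝ) ≠ 0),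
      show c * (√(2 * π))⁻¹ * Gamma (1 + τ) = c * Gamma (1 + τ) / √(2 * π) by ring]
    ring
  have hlim : ∀ y, Tendsto (fun n : ℕ => (n : ℝ) * J (a n * y + b n)) atTop (nhds (exp (-y))) := by
    intro y
    refine (tendsto_nat_mul_of_norming (x := y) (by positivity) hJlim).congr' ?_
    filter_upwards [hu_eq y] with n hn
    rw [hn]
  have hu_pos : ∀ y, ∀ᶠ n : ℕ in atTop, 0 < a n * y + b n := by
    intro y
    filter_upwards [hu_eq y, ((tendsto_sqrt_add_affine_log_div_sqrt _ _).comp hL).eventually_gt_atTop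
      0] with n hn hn'
    rw [hn]
    exact hn'
  intro x
  have hcont : Tendsto (fun y : ℝ => exp (-y)) (nhds x) (nhds (exp (-x))) :=
    (continuous_exp.comp continuous_neg).tendsto x
  refine tendsto_order.2 ⟨fun z hz => ?_, fun z hz => ?_⟩
  · obtain ⟨y, hy, hxy⟩ := (((hcont.eventually (lt_mem_nhds hz)).filter_mono
      nhdsWithin_le_nhds).and (self_mem_nhdsWithin (s := Set.Ioi x))).exists
    filter_upwards [(hlim y).eventually (lt_mem_nhds hy), hu_pos x, ha_pos] with n h1 h2 h3
    have hlt : a n * x + b n < a n * y + b n := by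
      have := mul_lt_mul_of_pos_left (show x < y from hxy) h3
      linarith
    exact h1.trans_le (mul_le_mul_of_nonneg_left (lower _ _ h2 hlt) n.cast_nonneg)
  · obtain ⟨y, hy, hxy⟩ := (((hcont.eventually (gt_mem_nhds hz)).filter_mono
      nhdsWithin_le_nhds).and (self_mem_nhdsWithin (s := Set.Iio x))).exists
    filter_upwards [(hlim y).eventually (gt_mem_nhds hy), hu_pos y, ha_pos] with n h1 h2 h3
    have hlt : a n * y + b n < a n * x + b n := by
      have := mul_lt_mul_of_pos_left (show y < x from hxy) h3
      linarith
    exact (mul_le_mul_of_nonneg_left (upper _ _ h2 hlt) n.cast_nonneg).trans_lt h1
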